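/- arXiv:2409.18112 — 8 statements merged into one kernel-verified Lean document; each statement's English description precedes it below -/
import Mathlib

section
/- Let c₁, c₂ : ℝⁿ → [0,∞) be lower semicontinuous functions such that the cost spaces (ℝⁿ × ℝⁿ, (x,y) ↦ c₁(x−y)) and (ℝⁿ × ℝⁿ, (x,y) ↦ c₂(x−y)) are NNCC spaces, and assume that c₁ or c₂ is coercive, i.e. cᵢ(v) → ∞ as ‖v‖ → ∞. Define the infimal convolution (c₁ ⊞ c₂)(x,y) = inf{c₁(x'−y') + c₂(x''−y'') : x'+x'' = x, y'+y'' = y}, a real number since the infimum is over a nonempty set of nonnegative reals. Then (ℝⁿ × ℝⁿ, c₁ ⊞ c₂) is an NNCC space. -/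
/-- A variational c-segment on a cost space `(X × Y, c)` with real-valued cost. -/
def IsVarCSegment {X Y : Type*} (c : X → Y → ℝ) (x : ℝ → X) (ybar : Y) : Prop :=
  ∀ s ∈ Set.Ioo (0:ℝ) 1, ∀ y : Y,
    c (x s) ybar - c (x s) y ≤
      (1 - s) * (c (x 0) ybar - c (x 0) y) + s * (c (x 1) ybar - c (x 1) y)

/-- `(X × Y, c)` is an NNCC space. -/
def IsNNCC {X Y : Type*} (c : X → Y → ℝ) : Prop :=
  ∀ x0 x1 : X, ∀ ybar : Y,
    ∃ x : ℝ → X, x 0 = x0 ∧ x 1 = x1 ∧ IsVarCSegment c x ybar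

/-- The infimal convolution of the translation-invariant costs `c1 (x - y)` and
`c2 (x - y)` on `ℝⁿ × ℝⁿ`. -/
noncomputable def infConv {n : ℕ} (c1 c2 : (Fin n → ℝ) → ℝ)
    (x y : Fin n → ℝ) : ℝ :=
  sInf {r : ℝ | ∃ x' x'' y' y'' : Fin n → ℝ, x' + x'' = x ∧ y' + y'' = y ∧
    r = c1 (x' - y') + c2 (x'' - y'')}

section InfConv

variable {n : ℕ} {c1 c2 : (Fin n → ℝ) → ℝ}

lemma exists_forall_add_le_of_coercive
    (h2nn : ∀ v, 0 ≤ c2 v)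
    (h1lsc : LowerSemicontinuous c1) (h2lsc : LowerSemicontinuous c2)
    (hcoer : Filter.Tendsto c1 (Filter.comap norm Filter.atTop) Filter.atTop)
    (v : Fin n → ℝ) :
    ∃ a b, a + b = v ∧ ∀ p q, p + q = v → c1 a + c2 b ≤ c1 p + c2 q := by
  have hlsc : LowerSemicontinuous fun w => c1 w + c2 (v - w) :=
    h1lsc.add (h2lsc.comp (continuous_const.sub continuous_id))
  set K : Set (Fin n → ℝ) := {w | c1 w ≤ c1 0 + c2 v}
  have hK : IsCompact K := by
    refine Metric.isCompact_of_isClosed_isBounded (h1lsc.isClosed_preimage _) ?_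
    rw [comap_norm_atTop] at hcoer
    rw [Bornology.isBounded_def]
    filter_upwards [hcoer.eventually_gt_atTop (c1 0 + c2 v)] with w hw
    simpa [K] using hw
  have h0 : (0 : Fin n → ℝ) ∈ K := by simpa [K] using h2nn v
  obtain ⟨a, -, hmin⟩ := (hlsc.lowerSemicontinuousOn K).exists_isMinOn ⟨0, h0⟩ hK
  refine ⟨a, v - a, by abel, fun p q hpq => ?_⟩
  obtain rfl : q = v - p := by rw [← hpq]; abel
  by_cases hp : p ∈ K
  · exact hmin hp
  · have h : c1 a + c2 (v - a) ≤ c1 0 + c2 (v - 0) := hmin h0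
    rw [sub_zero] at h
    have hp' : c1 0 + c2 v < c1 p := not_le.mp hp
    linarith [h2nn (v - p)]

lemma infConv_le (h1nn : ∀ v, 0 ≤ c1 v) (h2nn : ∀ v, 0 ≤ c2 v)
    {x y p q : Fin n → ℝ} (h : p + q = x - y) : infConv c1 c2 x y ≤ c1 p + c2 q := by
  refine csInf_le ⟨0, ?_⟩ ⟨p + y, q, y, 0, ?_, by simp, by simp⟩
  · rintro r ⟨x', x'', y', y'', -, -, rfl⟩
    exact add_nonneg (h1nn _) (h2nn _)
  · rw [add_right_comm, h, sub_add_cancel]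

lemma le_infConv {x y : Fin n → ℝ} {m : ℝ}
    (h : ∀ p q, p + q = x - y → m ≤ c1 p + c2 q) : m ≤ infConv c1 c2 x y := by
  refine le_csInf ⟨_, x, 0, y, 0, by simp, by simp, rfl⟩ ?_
  rintro r ⟨x', x'', y', y'', rfl, rfl, rfl⟩
  exact h _ _ (by abel)

lemma isNNCC_infConv_of_attained (h1nn : ∀ v, 0 ≤ c1 v) (h2nn : ∀ v, 0 ≤ c2 v)
    (hatt : ∀ v, ∃ a b, a + b = v ∧ ∀ p q, p + q = v → c1 a + c2 b ≤ c1 p + c2 q)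
    (hnncc1 : IsNNCC (fun x y : Fin n → ℝ => c1 (x - y)))
    (hnncc2 : IsNNCC (fun x y : Fin n → ℝ => c2 (x - y))) :
    IsNNCC (infConv c1 c2) := by
  intro x0 x1 ybar
  obtain ⟨a0, b0, hab0, hmin0⟩ := hatt (x0 - ybar)
  obtain ⟨a1, b1, hab1, hmin1⟩ := hatt (x1 - ybar)
  obtain ⟨a, rfl, rfl, ha⟩ := hnncc1 a0 a1 0
  obtain ⟨b, rfl, rfl, hb⟩ := hnncc2 b0 b1 0
  have hx0 : a 0 + b 0 + ybar = x0 := by rw [hab0, sub_add_cancel]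
  have hx1 : a 1 + b 1 + ybar = x1 := by rw [hab1, sub_add_cancel]
  refine ⟨fun s => a s + b s + ybar, hx0, hx1, fun s hs y => ?_⟩
  simp only [hx0, hx1]
  rw [sub_le_comm]
  refine le_infConv fun p q hpq => ?_
  have e : (a s - p) + (b s - q) = y - ybar := by
    rw [sub_add_sub_comm, hpq]; abel
  have key1 := ha s hs (a s - p)
  have key2 := hb s hs (b s - q)
  simp only [sub_zero, sub_sub_cancel] at key1 key2
  have hs_le : infConv c1 c2 (a s + b s + ybar) ybar ≤ c1 (a s) + c2 (b s) :=
    infConv_le h1nn h2nn (by abel)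
  have shift : ∀ t x, a t + b t = x - ybar →
      infConv c1 c2 x y ≤ c1 (a t - (a s - p)) + c2 (b t - (b s - q)) := fun t x h =>
    infConv_le h1nn h2nn (by rw [sub_add_sub_comm, h, e]; abel)
  have h0 : c1 (a 0) + c2 (b 0) - (c1 (a 0 - (a s - p)) + c2 (b 0 - (b s - q))) ≤
      infConv c1 c2 x0 ybar - infConv c1 c2 x0 y :=
    sub_le_sub (le_infConv hmin0) (shift 0 x0 hab0)
  have h1 : c1 (a 1) + c2 (b 1) - (c1 (a 1 - (a s - p)) + c2 (b 1 - (b s - q))) ≤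
      infConv c1 c2 x1 ybar - infConv c1 c2 x1 y :=
    sub_le_sub (le_infConv hmin1) (shift 1 x1 hab1)
  have h0' := mul_le_mul_of_nonneg_left h0 (sub_nonneg.mpr hs.2.le)
  have h1' := mul_le_mul_of_nonneg_left h1 hs.1.le
  linarith

end InfConv

/-- The infimal convolution of two nonnegative lower semicontinuous
translation-invariant NNCC costs on `ℝⁿ`, one of which is coercive, is an NNCC cost. -/
theorem infimal_convolution_NNCC {n : ℕ} (c1 c2 : (Fin n → ℝ) → ℝ)
    (h1nn : ∀ v, 0 ≤ c1 v) (h2nn : ∀ v, 0 ≤ c2 v)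
    (h1lsc : LowerSemicontinuous c1) (h2lsc : LowerSemicontinuous c2)
    (hcoer : Filter.Tendsto c1 (Filter.comap norm Filter.atTop) Filter.atTop ∨
             Filter.Tendsto c2 (Filter.comap norm Filter.atTop) Filter.atTop)
    (hnncc1 : IsNNCC (fun x y : Fin n → ℝ => c1 (x - y)))
    (hnncc2 : IsNNCC (fun x y : Fin n → ℝ => c2 (x - y))) :
    IsNNCC (infConv c1 c2) := by
  refine isNNCC_infConv_of_attained h1nn h2nn (fun v => ?_) hnncc1 hnncc2
  rcases hcoer with h | h
  · exact exists_forall_add_le_of_coercive h2nn h1lsc h2lsc h v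
  · obtain ⟨b, a, hab, hmin⟩ := exists_forall_add_le_of_coercive h1nn h2lsc h1lsc h v
    refine ⟨a, b, by rw [add_comm, hab], fun p q hpq => ?_⟩
    rw [add_comm (c1 a), add_comm (c1 p)]
    exact hmin q p (by rw [add_comm, hpq])
end

section
/- Let (X,d) be a metric space, ȳ ∈ X, and let (x, ȳ) be a variational c-segment on (X × X, c) for the cost c(x,y) = d(x,y)². Then for all s ∈ [0,1], d(x(s),ȳ)² ≤ (1−s)·d(x(0),ȳ)² + s·d(x(1),ȳ)² − s(1−s)·d(x(0),x(1))². -/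
/-- In a metric space, the squared distance to the base point of a
variational c-segment for the cost `d²` is `1`-convex along the segment. -/
theorem sq_dist_one_convex_along_var_csegment
    {X : Type*} [MetricSpace X] (x : ℝ → X) (ybar : X)
    (h : IsVarCSegment (fun a b : X => dist a b ^ 2) x ybar) :
    ∀ s ∈ Set.Icc (0:ℝ) 1,
      dist (x s) ybar ^ 2 ≤
        (1 - s) * dist (x 0) ybar ^ 2 + s * dist (x 1) ybar ^ 2
          - s * (1 - s) * dist (x 0) (x 1) ^ 2 := by
  rintro s ⟨hs0, hs1⟩
  rcases hs0.eq_or_lt with rfl | hs0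
  · simp
  rcases hs1.eq_or_lt with rfl | hs1
  · simp
  have hseg := h s ⟨hs0, hs1⟩ (x s)
  simp only [dist_self] at hseg
  have htri : dist (x 0) (x 1) ^ 2 ≤ (dist (x 0) (x s) + dist (x 1) (x s)) ^ 2 :=
    pow_le_pow_left₀ dist_nonneg (dist_triangle_right _ _ _) 2
  have hmul := mul_le_mul_of_nonneg_left htri (mul_pos hs0 (sub_pos.2 hs1)).le
  linear_combination
    hseg + hmul + sq_nonneg ((1 - s) * dist (x 0) (x s) - s * dist (x 1) (x s))
end

section
/- Let (X,d) be a geodesic space such that (X × X, c) is an NNCC space for the cost c(x,y) = d(x,y)². Then (X,d) is positively curved in the sense of Alexandrov. -/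
/-- A constant-speed geodesic parametrized by `[0,1]`. -/
def IsGeodesic {X : Type*} [MetricSpace X] (γ : ℝ → X) : Prop :=
  ∀ s ∈ Set.Icc (0:ℝ) 1, ∀ t ∈ Set.Icc (0:ℝ) 1,
    dist (γ s) (γ t) = |s - t| * dist (γ 0) (γ 1)

/-- `(X, d)` is a geodesic space: any two points are joined by a constant-speed geodesic. -/
def IsGeodesicSpace (X : Type*) [MetricSpace X] : Prop :=
  ∀ x0 x1 : X, ∃ γ : ℝ → X, γ 0 = x0 ∧ γ 1 = x1 ∧ IsGeodesic γ

/-- `(X, d)` is positively curved (PC) in the sense of Alexandrov: it is a geodesic space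
and every constant-speed geodesic satisfies the PC inequality. -/
def IsPCSpace (X : Type*) [MetricSpace X] : Prop :=
  IsGeodesicSpace X ∧
  ∀ γ : ℝ → X, IsGeodesic γ → ∀ s ∈ Set.Icc (0:ℝ) 1, ∀ y : X,
    (1 - s) * dist (γ 0) y ^ 2 + s * dist (γ 1) y ^ 2
      - s * (1 - s) * dist (γ 0) (γ 1) ^ 2 ≤ dist (γ s) y ^ 2

/-- A geodesic space whose squared distance cost is NNCC is positively
curved in the sense of Alexandrov. -/
theorem NNCC_implies_PC {X : Type*} [MetricSpace X]
    (hgeo : IsGeodesicSpace X)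
    (hnncc : IsNNCC (fun a b : X => dist a b ^ 2)) :
    IsPCSpace X := by
  refine ⟨hgeo, fun γ hγ s hs y => ?_⟩
  rcases hs.1.eq_or_lt with rfl | hs0
  · simp
  rcases hs.2.eq_or_lt with rfl | hs1
  · simp
  obtain ⟨x, hx0, hx1, hx⟩ := hnncc (γ 0) (γ 1) (γ s)
  have hd0 : dist (γ 0) (γ s) = s * dist (γ 0) (γ 1) := by
    rw [hγ 0 (by simp) s hs, zero_sub, abs_neg, abs_of_pos hs0]
  have hd1 : dist (γ 1) (γ s) = (1 - s) * dist (γ 0) (γ 1) := by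
    rw [hγ 1 (by simp) s hs, abs_of_pos (sub_pos.2 hs1)]
  have key := hx s ⟨hs0, hs1⟩
  simp only [hx0, hx1, hd0, hd1] at key
  have hxs : x s = γ s := by
    have h := key (x s)
    rw [dist_self] at h
    have htri : dist (γ 0) (γ 1) ^ 2 ≤ (dist (γ 0) (x s) + dist (γ 1) (x s)) ^ 2 :=
      pow_le_pow_left₀ dist_nonneg (dist_triangle_right _ _ _) 2
    have hmul := mul_le_mul_of_nonneg_left htri (mul_pos hs0 (sub_pos.2 hs1)).le
    have hzero : dist (x s) (γ s) ^ 2 ≤ 0 := by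
      linarith [sq_nonneg ((1 - s) * dist (γ 0) (x s) - s * dist (γ 1) (x s))]
    exact dist_eq_zero.1 (pow_eq_zero_iff two_ne_zero |>.1 (le_antisymm hzero (sq_nonneg _)))
  have h := key y
  rw [hxs, dist_self] at h
  linarith
end

section
/- Let (X,d) be a geodesic space, γ : [0,1] → X a constant-speed geodesic, and t ∈ [0,1]. Then the following are equivalent: (a) γ satisfies the PC inequality, i.e. for all s ∈ [0,1] and all y ∈ X, d(γ(s),y)² ≥ (1−s)·d(γ(0),y)² + s·d(γ(1),y)² − s(1−s)·d(γ(0),γ(1))²; (b) the path s ↦ (γ(s), γ(t)) is a variational c-segment on (X × X, d²). In particular, in a positively curved geodesic space, for every constant-speed geodesic γ and every t ∈ [0,1] the path s ↦ (γ(s), γ(t)) is a variational c-segment on (X × X, d²). -/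
/-- Along a constant-speed geodesic, the PC inequality with respect to a point of the geodesic
itself is an equality. -/
theorem IsGeodesic.dist_sq_eq {X : Type*} [MetricSpace X] {γ : ℝ → X} (hγ : IsGeodesic γ)
    {s t : ℝ} (hs : s ∈ Set.Icc (0:ℝ) 1) (ht : t ∈ Set.Icc (0:ℝ) 1) :
    dist (γ s) (γ t) ^ 2 =
      (1 - s) * dist (γ 0) (γ t) ^ 2 + s * dist (γ 1) (γ t) ^ 2
        - s * (1 - s) * dist (γ 0) (γ 1) ^ 2 := by
  rw [hγ s hs t ht, hγ 0 (by simp) t ht, hγ 1 (by simp) t ht]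
  simp only [mul_pow, sq_abs]
  ring

/-- For a constant-speed geodesic `γ` in a geodesic space and any
`t ∈ [0,1]`, the PC inequality along `γ` is equivalent to `s ↦ (γ s, γ t)` being a
variational c-segment for the cost `d²`. In particular, in a positively curved geodesic
space, `s ↦ (γ s, γ t)` is always a variational c-segment. -/
theorem geodesic_PC_iff_var_csegment {X : Type*} [MetricSpace X]
    (hgeo : IsGeodesicSpace X)
    (γ : ℝ → X) (hγ : IsGeodesic γ) (t : ℝ) (ht : t ∈ Set.Icc (0:ℝ) 1) :
    ((∀ s ∈ Set.Icc (0:ℝ) 1, ∀ y : X,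
        (1 - s) * dist (γ 0) y ^ 2 + s * dist (γ 1) y ^ 2
          - s * (1 - s) * dist (γ 0) (γ 1) ^ 2 ≤ dist (γ s) y ^ 2)
      ↔ IsVarCSegment (fun a b : X => dist a b ^ 2) γ (γ t)) ∧
    (IsPCSpace X → IsVarCSegment (fun a b : X => dist a b ^ 2) γ (γ t)) := by
  have pc_iff : (∀ s ∈ Set.Icc (0:ℝ) 1, ∀ y : X,
      (1 - s) * dist (γ 0) y ^ 2 + s * dist (γ 1) y ^ 2
        - s * (1 - s) * dist (γ 0) (γ 1) ^ 2 ≤ dist (γ s) y ^ 2)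
      ↔ IsVarCSegment (fun a b : X => dist a b ^ 2) γ (γ t) := by
    constructor
    · intro h s hs y
      have hs' := Set.Ioo_subset_Icc_self hs
      linarith [h s hs' y, hγ.dist_sq_eq hs' ht]
    · intro h s hs y
      rcases hs.1.eq_or_lt with rfl | h0
      · simp
      rcases hs.2.eq_or_lt with rfl | h1
      · simp
      have hseg := h s ⟨h0, h1⟩ y
      dsimp only at hseg
      linarith [hγ.dist_sq_eq hs ht]
  exact ⟨pc_iff, fun hX => pc_iff.mp (hX.2 γ hγ)⟩
end

section
/- Let f : ℝ → ℝ be locally Lipschitz with f ≥ 0 on [0,∞). Let (X_n, d_n), n ∈ ℕ, and (Z, d_Z) be nonempty compact metric spaces such that the Gromov–Hausdorff distance between X_n and Z tends to 0 as n → ∞. If for every n the cost space (X_n × X_n, c_n) with c_n(x,y) = f(d_n(x,y)) is an NNCC space, then (Z × Z, c_Z) with c_Z(x,y) = f(d_Z(x,y)) is an NNCC space. -/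
/-- If the Gromov-Hausdorff distance of two compact spaces is smaller than `δ`, there are maps
in both directions which are compatible up to an error `2 * δ`. -/
theorem exists_approx_of_ghDist_lt {X Z : Type*} [MetricSpace X] [CompactSpace X] [Nonempty X]
    [MetricSpace Z] [CompactSpace Z] [Nonempty Z] {δ : ℝ}
    (h : GromovHausdorff.ghDist X Z < δ) :
    ∃ (φ : Z → X) (ψ : X → Z), (∀ a b, |dist (φ a) (φ b) - dist a b| < 2 * δ) ∧
      ∀ x b, |dist x (φ b) - dist (ψ x) b| < 2 * δ := by
  obtain ⟨Φ, Ψ, hΦ, hΨ, hd⟩ := GromovHausdorff.ghDist_eq_hausdorffDist X Z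
  rw [hd] at h
  have hfin : Metric.hausdorffEDist (Set.range Φ) (Set.range Ψ) ≠ ⊤ :=
    Metric.hausdorffEDist_ne_top_of_nonempty_of_bounded (Set.range_nonempty _)
      (Set.range_nonempty _) (isCompact_range hΦ.continuous).isBounded
      (isCompact_range hΨ.continuous).isBounded
  have hφ : ∀ b : Z, ∃ x : X, dist (Φ x) (Ψ b) < δ := fun b => by
    obtain ⟨_, ⟨x, rfl⟩, hx⟩ :=
      Metric.exists_dist_lt_of_hausdorffDist_lt' (Set.mem_range_self b) h hfin
    exact ⟨x, hx⟩
  have hψ : ∀ x : X, ∃ b : Z, dist (Φ x) (Ψ b) < δ := fun x => by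
    obtain ⟨_, ⟨b, rfl⟩, hb⟩ :=
      Metric.exists_dist_lt_of_hausdorffDist_lt (Set.mem_range_self x) h hfin
    exact ⟨b, hb⟩
  choose φ hφ using hφ
  choose ψ hψ using hψ
  have key : ∀ x a y b, dist (Φ x) (Ψ a) < δ → dist (Φ y) (Ψ b) < δ →
      |dist x y - dist a b| < 2 * δ := fun x a y b hxa hyb => by
    rw [← hΦ.dist_eq x y, ← hΨ.dist_eq a b, ← Real.dist_eq]
    linarith [dist_dist_dist_le (Φ x) (Φ y) (Ψ a) (Ψ b)]
  exact ⟨φ, ψ, fun a b => key _ _ _ _ (hφ a) (hφ b), fun x b => key _ _ _ _ (hψ x) (hφ b)⟩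

/-- In a Gromov-Hausdorff limit of NNCC spaces, intermediate points of variational `c`-segments
exist up to an arbitrarily small error. -/
theorem exists_approx_varCSegment_point {f : ℝ → ℝ} (hf : Continuous f)
    {X : ℕ → Type*} [∀ n, MetricSpace (X n)] [∀ n, CompactSpace (X n)] [∀ n, Nonempty (X n)]
    {Z : Type*} [MetricSpace Z] [CompactSpace Z] [Nonempty Z]
    (hconv : Filter.Tendsto (fun n => GromovHausdorff.ghDist (X n) Z) Filter.atTop (nhds 0))
    (hnncc : ∀ n, IsNNCC (fun a b : X n => f (dist a b))) (z0 z1 w : Z) {s : ℝ}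
    (hs : s ∈ Set.Ioo (0 : ℝ) 1) {ε : ℝ} (hε : 0 < ε) :
    ∃ z : Z, ∀ y : Z, f (dist z w) - f (dist z y) ≤
      (1 - s) * (f (dist z0 w) - f (dist z0 y)) + s * (f (dist z1 w) - f (dist z1 y)) + ε := by
  have hunif := isCompact_Icc (a := (0 : ℝ)) (b := Metric.diam (Set.univ : Set Z))
    |>.uniformContinuousAt_of_continuousAt f (fun t _ => hf.continuousAt)
      (Metric.dist_mem_uniformity (show 0 < ε / 4 by linarith))
  obtain ⟨δ, hδ, hfδ⟩ := Metric.mem_uniformity_dist.1 hunif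
  obtain ⟨n, hn⟩ := (hconv.eventually (gt_mem_nhds (half_pos hδ))).exists
  obtain ⟨φ, ψ, hφ, hψ⟩ := exists_approx_of_ghDist_lt hn
  have close : ∀ (a b : Z) (t : ℝ), |t - dist a b| < 2 * (δ / 2) →
      |f t - f (dist a b)| < ε / 4 := fun a b t ht => by
    have hab : dist a b ∈ Set.Icc 0 (Metric.diam (Set.univ : Set Z)) :=
      ⟨dist_nonneg, Metric.dist_le_diam_of_mem isCompact_univ.isBounded trivial trivial⟩
    rw [abs_sub_comm]
    refine hfδ (a := dist a b) (b := t) ?_ hab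
    rw [dist_comm, Real.dist_eq]
    linarith
  obtain ⟨x, hx0, hx1, hx⟩ := hnncc n (φ z0) (φ z1) (φ w)
  refine ⟨ψ (x s), fun y => ?_⟩
  have hxy := hx s hs (φ y)
  simp only [hx0, hx1] at hxy
  have h1 := abs_lt.1 (close _ _ _ (hψ (x s) w))
  have h2 := abs_lt.1 (close _ _ _ (hψ (x s) y))
  have h3 := abs_lt.1 (close _ _ _ (hφ z0 w))
  have h4 := abs_lt.1 (close _ _ _ (hφ z0 y))
  have h5 := abs_lt.1 (close _ _ _ (hφ z1 w))
  have h6 := abs_lt.1 (close _ _ _ (hφ z1 y))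
  have h0 : (1 - s) * (f (dist (φ z0) (φ w)) - f (dist (φ z0) (φ y))) ≤
      (1 - s) * (f (dist z0 w) - f (dist z0 y) + ε / 2) :=
    mul_le_mul_of_nonneg_left (by linarith) (by linarith [hs.2])
  have h0' : s * (f (dist (φ z1) (φ w)) - f (dist (φ z1) (φ y))) ≤
      s * (f (dist z1 w) - f (dist z1 y) + ε / 2) :=
    mul_le_mul_of_nonneg_left (by linarith) hs.1.le
  linarith

/-- A compactness argument removes the error in `exists_approx_varCSegment_point`. -/
theorem exists_varCSegment_point_of_approx {X Y : Type*} [MetricSpace X] [CompactSpace X]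
    {c : X → Y → ℝ} (hc : ∀ y, Continuous fun x => c x y) (w : Y) (r : Y → ℝ)
    (h : ∀ ε > 0, ∃ z, ∀ y, c z w - c z y ≤ r y + ε) :
    ∃ z, ∀ y, c z w - c z y ≤ r y := by
  choose z hz using fun k : ℕ => h (1 / ((k : ℝ) + 1)) Nat.one_div_pos_of_nat
  obtain ⟨z', -, k, hk, hlim⟩ := isCompact_univ.tendsto_subseq fun n => Set.mem_univ (z n)
  refine ⟨z', fun y => le_of_tendsto_of_tendsto'
    ((((hc w).sub (hc y)).tendsto z').comp hlim) ?_ fun n => hz (k n) y⟩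
  simpa using (tendsto_one_div_add_atTop_nhds_zero_nat.comp hk.tendsto_atTop).const_add (r y)

/-- For costs of the form `f ∘ d` with `f` locally Lipschitz and
nonnegative on `[0, ∞)`, the class of NNCC spaces is closed under Gromov--Hausdorff
convergence of nonempty compact metric spaces. -/
theorem NNCC_stable_under_GH_convergence
    (f : ℝ → ℝ) (hf : LocallyLipschitz f) (hfnn : ∀ t : ℝ, 0 ≤ t → 0 ≤ f t)
    (X : ℕ → Type*) [∀ n, MetricSpace (X n)] [∀ n, CompactSpace (X n)]
    [∀ n, Nonempty (X n)]
    (Z : Type*) [MetricSpace Z] [CompactSpace Z] [Nonempty Z]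
    (hconv : Filter.Tendsto (fun n => GromovHausdorff.ghDist (X n) Z)
      Filter.atTop (nhds 0))
    (hnncc : ∀ n, IsNNCC (fun a b : X n => f (dist a b))) :
    IsNNCC (fun a b : Z => f (dist a b)) := by
  intro z0 z1 w
  have hpoint : ∀ s ∈ Set.Ioo (0 : ℝ) 1, ∃ z : Z, ∀ y : Z, f (dist z w) - f (dist z y) ≤
      (1 - s) * (f (dist z0 w) - f (dist z0 y)) + s * (f (dist z1 w) - f (dist z1 y)) :=
    fun s hs => exists_varCSegment_point_of_approx (c := fun a b : Z => f (dist a b))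
      (fun y => hf.continuous.comp (continuous_id.dist continuous_const)) w _
      fun _ hε => exists_approx_varCSegment_point hf.continuous hconv hnncc z0 z1 w hs hε
  choose! x hx using hpoint
  classical
  refine ⟨fun s => if s = 0 then z0 else if s = 1 then z1 else x s, by simp, by simp,
    fun s hs y => ?_⟩
  simpa [hs.1.ne', hs.2.ne] using hx s hs y
end

section
/- Let X and Y be sets and c : X × Y → ℝ a real-valued cost. For φ : Y → ℝ and ȳ ∈ Y define ∂ᶜφ(ȳ) = {x ∈ X : for all y ∈ Y, c(x,ȳ) − φ(ȳ) ≤ c(x,y) − φ(y)}, and let Φᶜ₀ = {φ : Y → ℝ : ∂ᶜφ(ȳ) ≠ ∅ for every ȳ ∈ Y}. Then (X × Y, c) is an NNCC space if and only if Φᶜ₀ is convex, i.e. for all φ₀, φ₁ ∈ Φᶜ₀ and every s ∈ (0,1), the function (1−s)·φ₀ + s·φ₁ belongs to Φᶜ₀. -/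
/-- The c-subdifferential of `φ : Y → ℝ` at `ȳ`. -/
def CSubdiff {X Y : Type*} (c : X → Y → ℝ) (φ : Y → ℝ) (ybar : Y) : Set X :=
  {x : X | ∀ y : Y, c x ybar - φ ybar ≤ c x y - φ y}

/-- The set `Φᶜ₀` of real-valued functions with everywhere nonempty c-subdifferential. -/
def PhiC0 {X Y : Type*} (c : X → Y → ℝ) : Set (Y → ℝ) :=
  {φ : Y → ℝ | ∀ ybar : Y, (CSubdiff c φ ybar).Nonempty}

/-- Figalli–Kim–McCann-type characterization: for a real-valued cost,
`(X × Y, c)` is an NNCC space iff the set `Φᶜ₀` is convex. -/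
theorem NNCC_iff_PhiC0_convex {X Y : Type*} (c : X → Y → ℝ) :
    IsNNCC c ↔
    (∀ φ0 ∈ PhiC0 c, ∀ φ1 ∈ PhiC0 c, ∀ s ∈ Set.Ioo (0:ℝ) 1,
      (fun y => (1 - s) * φ0 y + s * φ1 y) ∈ PhiC0 c) := by
  constructor
  · intro h φ0 h0 φ1 h1 s hs ybar
    obtain ⟨x0, hx0⟩ := h0 ybar
    obtain ⟨x1, hx1⟩ := h1 ybar
    obtain ⟨x, rfl, rfl, hx⟩ := h x0 x1 ybar
    refine ⟨x s, fun y => ?_⟩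
    have key := hx s hs y
    have e0 := mul_le_mul_of_nonneg_left (hx0 y) (sub_nonneg.2 hs.2.le)
    have e1 := mul_le_mul_of_nonneg_left (hx1 y) hs.1.le
    simp only
    linarith
  · intro h x0 x1 ybar
    have hc (x : X) : c x ∈ PhiC0 c := fun _ => ⟨x, fun y => by simp⟩
    have hex (s : ℝ) (hs : s ∈ Set.Ioo (0 : ℝ) 1) := h (c x0) (hc x0) (c x1) (hc x1) s hs ybar
    choose x hx using hex
    classical
    refine ⟨fun s => if hs : s ∈ Set.Ioo (0 : ℝ) 1 then x s hs else if s = 0 then x0 else x1,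
      by simp, by simp, fun s hs y => ?_⟩
    have key := hx s hs y
    simp only [hs, dite_true, Set.mem_Ioo, lt_irrefl, false_and, and_false, dite_false, if_true,
      one_ne_zero, if_false]
    linarith
end

section
/- Let X be a measurable space and, for probability measures μ, ν on X, define the squared Hellinger distance H²(μ,ν) = ∫ (√(dμ/dλ) − √(dν/dλ))² dλ, where λ = μ + ν and dμ/dλ, dν/dλ denote Radon–Nikodym derivatives. Then for all probability measures μ₀, μ₁, ν̄ on X there exists a path μ : [0,1] → 𝒫(X) with μ(0) = μ₀ and μ(1) = μ₁ such that for every probability measure σ on X the function s ↦ H²(μ(s), ν̄) − H²(μ(s), σ) is convex on [0,1]. In particular (𝒫(X) × 𝒫(X), H²) is an NNCC space. -/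
open MeasureTheory

/-- The squared Hellinger distance between two probability measures, computed with the
dominating measure `λ = μ + ν`. -/
noncomputable def hellingerSq {X : Type*} [MeasurableSpace X] (μ ν : Measure X) : ℝ :=
  ∫ x, (Real.sqrt ((μ.rnDeriv (μ + ν) x).toReal)
        - Real.sqrt ((ν.rnDeriv (μ + ν) x).toReal)) ^ 2 ∂(μ + ν)

open scoped RealInnerProductSpace

/-- Every chord between unit vectors can be pushed back to the unit sphere in the direction of a
unit vector `b`, by an amount that is a concave function of the chord parameter. -/
lemma exists_concaveOn_norm_add_smul_eq_one {V : Type*} [NormedAddCommGroup V]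
    [InnerProductSpace ℝ V] {u v b : V} (hu : ‖u‖ = 1) (hv : ‖v‖ = 1) (hb : ‖b‖ = 1)
    (hub : 0 ≤ ⟪u, b⟫) (hvb : 0 ≤ ⟪v, b⟫) :
    ∃ k : ℝ → ℝ, ConcaveOn ℝ (Set.Icc 0 1) k ∧ (∀ s ∈ Set.Icc (0 : ℝ) 1, 0 ≤ k s) ∧
      k 0 = 0 ∧ k 1 = 0 ∧
      ∀ s ∈ Set.Icc (0 : ℝ) 1, ‖(1 - s) • u + s • v + k s • b‖ = 1 := by
  set l : ℝ → V := fun s => (1 - s) • u + s • v with hl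
  have hp : ∀ s ∈ Set.Icc (0 : ℝ) 1, 0 ≤ ⟪l s, b⟫ := by
    rintro s ⟨h0, h1⟩
    simp only [hl, inner_add_left, real_inner_smul_left]
    have := sub_nonneg.2 h1
    positivity
  have hq : ∀ s ∈ Set.Icc (0 : ℝ) 1, ‖l s‖ ≤ 1 := by
    rintro s ⟨h0, h1⟩
    calc ‖l s‖ ≤ ‖(1 - s) • u‖ + ‖s • v‖ := norm_add_le _ _
      _ = 1 := by
        rw [norm_smul, norm_smul, hu, hv, Real.norm_of_nonneg h0,
          Real.norm_of_nonneg (sub_nonneg.2 h1)]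
        ring
  have hexp : ∀ s t : ℝ, ‖l s + t • b‖ ^ 2 = ‖l s‖ ^ 2 + 2 * t * ⟪l s, b⟫ + t ^ 2 := by
    intro s t
    rw [norm_add_sq_real, real_inner_smul_right, norm_smul, hb, Real.norm_eq_abs, mul_one, sq_abs]
    ring
  set k : ℝ → ℝ := fun s => √(⟪l s, b⟫ ^ 2 + (1 - ‖l s‖ ^ 2)) - ⟪l s, b⟫ with hk
  have hq2 : ∀ s ∈ Set.Icc (0 : ℝ) 1, 0 ≤ 1 - ‖l s‖ ^ 2 := fun s hs => by
    nlinarith [hq s hs, norm_nonneg (l s)]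
  have hk0 : ∀ s ∈ Set.Icc (0 : ℝ) 1, 0 ≤ k s := fun s hs =>
    sub_nonneg.2 (Real.le_sqrt_of_sq_le (by linarith [hq2 s hs]))
  have hnorm : ∀ s ∈ Set.Icc (0 : ℝ) 1, ‖l s + k s • b‖ = 1 := by
    intro s hs
    have h : ‖l s + k s • b‖ ^ 2 = 1 := by
      rw [hexp]
      have := Real.sq_sqrt (add_nonneg (sq_nonneg ⟪l s, b⟫) (hq2 s hs))
      simp only [hk]
      linear_combination this
    exact (pow_eq_one_iff_of_nonneg (norm_nonneg _) two_ne_zero).1 h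
  refine ⟨k, ⟨convex_Icc 0 1, ?_⟩, hk0, ?_, ?_, hnorm⟩
  · intro x hx y hy α β hα hβ hαβ
    have hs := convex_Icc (0 : ℝ) 1 hx hy hα hβ hαβ
    simp only [smul_eq_mul] at hs ⊢
    set s := α * x + β * y with hs_def
    have hcomb : l s + (α * k x + β * k y) • b = α • (l x + k x • b) + β • (l y + k y • b) := by
      obtain rfl : β = 1 - α := by linarith
      simp only [hl, hs_def]
      module
    have hle : ‖l s + (α * k x + β * k y) • b‖ ≤ 1 := by
      rw [hcomb]
      refine (norm_add_le _ _).trans_eq ?_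
      rw [norm_smul, norm_smul, hnorm x hx, hnorm y hy, Real.norm_of_nonneg hα,
        Real.norm_of_nonneg hβ, mul_one, mul_one, hαβ]
    by_contra! hlt
    have h1 := hexp s (α * k x + β * k y)
    have h2 := hexp s (k s)
    rw [hnorm s hs] at h2
    have h3 : ‖l s + (α * k x + β * k y) • b‖ ^ 2 ≤ 1 := pow_le_one₀ (norm_nonneg _) hle
    nlinarith [hk0 s hs, mul_nonneg (hp s hs) (sub_nonneg.2 hlt.le)]
  · simp [hk, hl, hu, Real.sqrt_sq hub]
  · simp [hk, hl, hv, Real.sqrt_sq hvb]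

section SqrtRnDeriv

variable {X : Type*} [MeasurableSpace X]

/-- The square root of the density of `μ` with respect to `ρ`. -/
noncomputable def sqrtRnDeriv (μ ρ : Measure X) (x : X) : ℝ :=
  √(μ.rnDeriv ρ x).toReal

lemma sqrtRnDeriv_nonneg (μ ρ : Measure X) (x : X) : 0 ≤ sqrtRnDeriv μ ρ x :=
  Real.sqrt_nonneg _

lemma sq_sqrtRnDeriv (μ ρ : Measure X) (x : X) :
    sqrtRnDeriv μ ρ x ^ 2 = (μ.rnDeriv ρ x).toReal :=
  Real.sq_sqrt ENNReal.toReal_nonneg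

lemma measurable_sqrtRnDeriv (μ ρ : Measure X) : Measurable (sqrtRnDeriv μ ρ) :=
  (μ.measurable_rnDeriv ρ).ennreal_toReal.sqrt

lemma memLp_sqrtRnDeriv (μ ρ : Measure X) [IsFiniteMeasure μ] :
    MemLp (sqrtRnDeriv μ ρ) 2 ρ := by
  rw [memLp_two_iff_integrable_sq (measurable_sqrtRnDeriv μ ρ).aestronglyMeasurable]
  simpa only [sq_sqrtRnDeriv] using Measure.integrable_toReal_rnDeriv

lemma integral_sq_sqrtRnDeriv {μ ρ : Measure X} [IsProbabilityMeasure μ] [SigmaFinite ρ]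
    (h : μ ≪ ρ) : ∫ x, sqrtRnDeriv μ ρ x ^ 2 ∂ρ = 1 := by
  simp only [sq_sqrtRnDeriv]
  rw [Measure.integral_toReal_rnDeriv h]
  simp

lemma sqrtRnDeriv_mul_sqrtRnDeriv {μ τ ρ : Measure X} [SigmaFinite μ] [SigmaFinite τ]
    [SigmaFinite ρ] (h : μ ≪ τ) :
    (fun x => sqrtRnDeriv μ τ x * sqrtRnDeriv τ ρ x) =ᵐ[ρ] sqrtRnDeriv μ ρ := by
  filter_upwards [Measure.rnDeriv_mul_rnDeriv (κ := ρ) h] with x hx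
  rw [sqrtRnDeriv, sqrtRnDeriv, sqrtRnDeriv, ← Real.sqrt_mul ENNReal.toReal_nonneg,
    ← ENNReal.toReal_mul, ← hx, Pi.mul_apply]

/-- The squared Hellinger distance may be computed with any dominating measure. -/
lemma hellingerSq_eq_integral_sq {μ ν ρ : Measure X} [IsFiniteMeasure μ] [IsFiniteMeasure ν]
    [SigmaFinite ρ] (hμ : μ ≪ ρ) (hν : ν ≪ ρ) :
    hellingerSq μ ν = ∫ x, (sqrtRnDeriv μ ρ x - sqrtRnDeriv ν ρ x) ^ 2 ∂ρ := by
  have hτ : μ + ν ≪ ρ := Measure.AbsolutelyContinuous.add_left hμ hν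
  have hμτ : μ ≪ μ + ν := Measure.AbsolutelyContinuous.rfl.add_right ν
  have hντ : ν ≪ μ + ν := by
    rw [add_comm]
    exact Measure.AbsolutelyContinuous.rfl.add_right μ
  rw [hellingerSq, ← integral_rnDeriv_smul hτ]
  refine integral_congr_ae ?_
  filter_upwards [sqrtRnDeriv_mul_sqrtRnDeriv (ρ := ρ) hμτ,
    sqrtRnDeriv_mul_sqrtRnDeriv (ρ := ρ) hντ] with x hx hy
  rw [← hx, ← hy, ← sq_sqrtRnDeriv, smul_eq_mul, ← sub_mul, mul_pow, mul_comm]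
  rfl

lemma hellingerSq_nonneg (μ ν : Measure X) : 0 ≤ hellingerSq μ ν :=
  integral_nonneg fun _ => sq_nonneg _

lemma hellingerSq_self (μ : Measure X) : hellingerSq μ μ = 0 := by
  simp [hellingerSq]

lemma hellingerSq_eq_two_sub {μ ν ρ : Measure X} [IsProbabilityMeasure μ]
    [IsProbabilityMeasure ν] [SigmaFinite ρ] (hμ : μ ≪ ρ) (hν : ν ≪ ρ) :
    hellingerSq μ ν = 2 - 2 * ∫ x, sqrtRnDeriv μ ρ x * sqrtRnDeriv ν ρ x ∂ρ := by
  have hi := (memLp_sqrtRnDeriv μ ρ).integrable_sq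
  have hj := (memLp_sqrtRnDeriv ν ρ).integrable_sq
  have hij : Integrable (fun x => sqrtRnDeriv μ ρ x * sqrtRnDeriv ν ρ x) ρ :=
    (memLp_sqrtRnDeriv μ ρ).integrable_mul (memLp_sqrtRnDeriv ν ρ)
  rw [hellingerSq_eq_integral_sq hμ hν]
  calc ∫ x, (sqrtRnDeriv μ ρ x - sqrtRnDeriv ν ρ x) ^ 2 ∂ρ
      = ∫ x, (sqrtRnDeriv μ ρ x ^ 2 + sqrtRnDeriv ν ρ x ^ 2)
          - 2 * (sqrtRnDeriv μ ρ x * sqrtRnDeriv ν ρ x) ∂ρ := by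
        congr 1 with x
        ring
    _ = _ := by
        rw [integral_sub (hi.fun_add hj) (hij.const_mul 2), integral_add hi hj, integral_const_mul,
          integral_sq_sqrtRnDeriv hμ, integral_sq_sqrtRnDeriv hν]
        norm_num

lemma withDensity_ofReal_sq_sqrtRnDeriv {μ τ : Measure X} [SigmaFinite μ] [SigmaFinite τ]
    (h : μ ≪ τ) : τ.withDensity (fun x => ENNReal.ofReal (sqrtRnDeriv μ τ x ^ 2)) = μ := by
  conv_rhs => rw [← Measure.withDensity_rnDeriv_eq μ τ h]
  refine withDensity_congr_ae ?_
  filter_upwards [Measure.rnDeriv_lt_top μ τ] with x hx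
  rw [sq_sqrtRnDeriv, ENNReal.ofReal_toReal hx.ne]

lemma sqrtRnDeriv_withDensity {τ ρ : Measure X} [SigmaFinite τ] [SigmaFinite ρ] (h : τ ≪ ρ)
    {f : X → ℝ} (hf : Measurable f) (hf0 : 0 ≤ f) :
    sqrtRnDeriv (τ.withDensity fun x => ENNReal.ofReal (f x ^ 2)) ρ
      =ᵐ[ρ] fun x => f x * sqrtRnDeriv τ ρ x := by
  filter_upwards [Measure.rnDeriv_withDensity_left_of_absolutelyContinuous h
    (f := fun x => ENNReal.ofReal (f x ^ 2)) (by fun_prop)] with x hx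
  rw [sqrtRnDeriv, hx, ENNReal.toReal_mul, ENNReal.toReal_ofReal (sq_nonneg _),
    Real.sqrt_mul (sq_nonneg _), Real.sqrt_sq (hf0 x), sqrtRnDeriv]

lemma MeasureTheory.MemLp.norm_toLp_sq {ρ : Measure X} {f : X → ℝ} (hf : MemLp f 2 ρ) :
    ‖hf.toLp f‖ ^ 2 = ∫ x, f x ^ 2 ∂ρ := by
  rw [← real_inner_self_eq_norm_sq, L2.inner_def]
  refine integral_congr_ae ?_
  filter_upwards [hf.coeFn_toLp] with x hx
  simp [hx, sq]

lemma MeasureTheory.MemLp.inner_toLp_nonneg {ρ : Measure X} {f g : X → ℝ} (hf : MemLp f 2 ρ)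
    (hg : MemLp g 2 ρ) (hf0 : 0 ≤ f) (hg0 : 0 ≤ g) : 0 ≤ ⟪hf.toLp f, hg.toLp g⟫ := by
  rw [L2.inner_def]
  refine integral_nonneg_of_ae ?_
  filter_upwards [hf.coeFn_toLp, hg.coeFn_toLp] with x hx hy
  simpa [hx, hy] using mul_nonneg (hg0 x) (hf0 x)

lemma norm_toLp_sqrtRnDeriv {μ τ : Measure X} [IsProbabilityMeasure μ] [SigmaFinite τ]
    (h : μ ≪ τ) : ‖(memLp_sqrtRnDeriv μ τ).toLp (sqrtRnDeriv μ τ)‖ = 1 := by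
  rw [← pow_eq_one_iff_of_nonneg (norm_nonneg _) two_ne_zero, MemLp.norm_toLp_sq,
    integral_sq_sqrtRnDeriv h]

/-- The affinity `2 - hellingerSq · σ` is linear in the square root of the density. -/
lemma hellingerSq_withDensity_linear_combination {μ₀ μ₁ ν τ σ : Measure X}
    [IsProbabilityMeasure μ₀] [IsProbabilityMeasure μ₁] [IsProbabilityMeasure ν]
    [IsProbabilityMeasure σ] [IsFiniteMeasure τ] (h₀ : μ₀ ≪ τ) (h₁ : μ₁ ≪ τ) (hν : ν ≪ τ)
    {f : X → ℝ} (hf0 : 0 ≤ f) {α β γ : ℝ}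
    (hf : f = fun x => α * sqrtRnDeriv μ₀ τ x + β * sqrtRnDeriv μ₁ τ x + γ * sqrtRnDeriv ν τ x)
    [IsProbabilityMeasure (τ.withDensity fun x => ENNReal.ofReal (f x ^ 2))] :
    hellingerSq (τ.withDensity fun x => ENNReal.ofReal (f x ^ 2)) σ =
      2 - (α * (2 - hellingerSq μ₀ σ) + β * (2 - hellingerSq μ₁ σ)
        + γ * (2 - hellingerSq ν σ)) := by
  set ρ := τ + σ with hρ
  have hτ : τ ≪ ρ := Measure.AbsolutelyContinuous.rfl.add_right σ
  have hσ : σ ≪ ρ := by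
    rw [hρ, add_comm]
    exact Measure.AbsolutelyContinuous.rfl.add_right τ
  have hfm : Measurable f := by
    have := measurable_sqrtRnDeriv μ₀ τ
    have := measurable_sqrtRnDeriv μ₁ τ
    have := measurable_sqrtRnDeriv ν τ
    rw [hf]
    fun_prop
  have hint : ∀ μ : Measure X, [IsProbabilityMeasure μ] →
      Integrable (fun x => sqrtRnDeriv μ ρ x * sqrtRnDeriv σ ρ x) ρ := fun μ _ =>
    (memLp_sqrtRnDeriv μ ρ).integrable_mul (memLp_sqrtRnDeriv σ ρ)
  rw [hellingerSq_eq_two_sub ((withDensity_absolutelyContinuous τ _).trans hτ) hσ,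
    hellingerSq_eq_two_sub (h₀.trans hτ) hσ, hellingerSq_eq_two_sub (h₁.trans hτ) hσ,
    hellingerSq_eq_two_sub (hν.trans hτ) hσ]
  have key : ∫ x, sqrtRnDeriv (τ.withDensity fun x => ENNReal.ofReal (f x ^ 2)) ρ x
        * sqrtRnDeriv σ ρ x ∂ρ
      = ∫ x, α * (sqrtRnDeriv μ₀ ρ x * sqrtRnDeriv σ ρ x)
          + β * (sqrtRnDeriv μ₁ ρ x * sqrtRnDeriv σ ρ x)
          + γ * (sqrtRnDeriv ν ρ x * sqrtRnDeriv σ ρ x) ∂ρ := by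
    refine integral_congr_ae ?_
    filter_upwards [sqrtRnDeriv_withDensity hτ hfm hf0, sqrtRnDeriv_mul_sqrtRnDeriv (ρ := ρ) h₀,
      sqrtRnDeriv_mul_sqrtRnDeriv (ρ := ρ) h₁, sqrtRnDeriv_mul_sqrtRnDeriv (ρ := ρ) hν]
      with x hx hx₀ hx₁ hxν
    rw [hx, ← hx₀, ← hx₁, ← hxν, hf]
    ring
  rw [key, integral_add (((hint μ₀).const_mul α).fun_add ((hint μ₁).const_mul β))
    ((hint ν).const_mul γ), integral_add ((hint μ₀).const_mul α) ((hint μ₁).const_mul β),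
    integral_const_mul, integral_const_mul, integral_const_mul]
  ring

lemma isProbabilityMeasure_withDensity_ofReal_sq {τ : Measure X} {f : X → ℝ} (hf : MemLp f 2 τ)
    (h : ‖hf.toLp f‖ = 1) :
    IsProbabilityMeasure (τ.withDensity fun x => ENNReal.ofReal (f x ^ 2)) := by
  refine ⟨?_⟩
  rw [withDensity_apply _ MeasurableSet.univ, Measure.restrict_univ,
    ← ofReal_integral_eq_lintegral_ofReal hf.integrable_sq (ae_of_all _ fun x => sq_nonneg _),
    ← hf.norm_toLp_sq, h]
  simp

/-- Two probability measures are joined by a path along which every affinity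
`2 - hellingerSq · σ` is affine up to a concave multiple of its value at `ν`. -/
lemma exists_path_hellingerSq_eq (μ₀ μ₁ ν : ProbabilityMeasure X) :
    ∃ (path : ℝ → ProbabilityMeasure X) (k : ℝ → ℝ), path 0 = μ₀ ∧ path 1 = μ₁ ∧
      ConcaveOn ℝ (Set.Icc 0 1) k ∧
      ∀ s ∈ Set.Icc (0 : ℝ) 1, ∀ σ : ProbabilityMeasure X,
        hellingerSq (path s : Measure X) (σ : Measure X) =
          2 - ((1 - s) * (2 - hellingerSq (μ₀ : Measure X) (σ : Measure X))
            + s * (2 - hellingerSq (μ₁ : Measure X) (σ : Measure X))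
            + k s * (2 - hellingerSq (ν : Measure X) (σ : Measure X))) := by
  set τ : Measure X := μ₀ + μ₁ + ν with hτ
  have h₀ : (μ₀ : Measure X) ≪ τ :=
    (Measure.AbsolutelyContinuous.rfl.add_right _).add_right _
  have h₁ : (μ₁ : Measure X) ≪ τ := by
    rw [hτ, add_comm (μ₀ : Measure X)]
    exact (Measure.AbsolutelyContinuous.rfl.add_right _).add_right _
  have hν : (ν : Measure X) ≪ τ := by
    rw [hτ, add_comm]
    exact Measure.AbsolutelyContinuous.rfl.add_right _
  have m₀ := memLp_sqrtRnDeriv (μ₀ : Measure X) τ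
  have m₁ := memLp_sqrtRnDeriv (μ₁ : Measure X) τ
  have mν := memLp_sqrtRnDeriv (ν : Measure X) τ
  have n₀ := sqrtRnDeriv_nonneg (μ₀ : Measure X) τ
  have n₁ := sqrtRnDeriv_nonneg (μ₁ : Measure X) τ
  have nν := sqrtRnDeriv_nonneg (ν : Measure X) τ
  obtain ⟨k, hk, hk_nonneg, hk0, hk1, hnorm⟩ := exists_concaveOn_norm_add_smul_eq_one
    (norm_toLp_sqrtRnDeriv h₀) (norm_toLp_sqrtRnDeriv h₁) (norm_toLp_sqrtRnDeriv hν)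
    (m₀.inner_toLp_nonneg mν n₀ nν) (m₁.inner_toLp_nonneg mν n₁ nν)
  set f : ℝ → X → ℝ := fun s x => (1 - s) * sqrtRnDeriv (μ₀ : Measure X) τ x
    + s * sqrtRnDeriv (μ₁ : Measure X) τ x + k s * sqrtRnDeriv (ν : Measure X) τ x with hf
  have hprob : ∀ s ∈ Set.Icc (0 : ℝ) 1,
      IsProbabilityMeasure (τ.withDensity fun x => ENNReal.ofReal (f s x ^ 2)) := fun s hs =>
    isProbabilityMeasure_withDensity_ofReal_sq
      (((m₀.const_smul (1 - s)).add (m₁.const_smul s)).add (mν.const_smul (k s))) (hnorm s hs)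
  obtain ⟨path, hpath⟩ : ∃ path : ℝ → ProbabilityMeasure X, ∀ s ∈ Set.Icc (0 : ℝ) 1,
      (path s : Measure X) = τ.withDensity fun x => ENNReal.ofReal (f s x ^ 2) := by
    have : Nonempty (ProbabilityMeasure X) := ⟨ν⟩
    choose! path hpath using fun s hs =>
      (⟨⟨_, hprob s hs⟩, rfl⟩ : ∃ P : ProbabilityMeasure X,
        (P : Measure X) = τ.withDensity fun x => ENNReal.ofReal (f s x ^ 2))
    exact ⟨path, hpath⟩
  refine ⟨path, k, ?_, ?_, hk, ?_⟩
  · refine Subtype.ext ((hpath 0 (by simp)).trans ?_)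
    simpa [hf, hk0] using withDensity_ofReal_sq_sqrtRnDeriv h₀
  · refine Subtype.ext ((hpath 1 (by simp)).trans ?_)
    simpa [hf, hk1] using withDensity_ofReal_sq_sqrtRnDeriv h₁
  · intro s hs σ
    have := hprob s hs
    have hf0 : 0 ≤ f s := fun x => by
      have := sub_nonneg.2 hs.2
      have := hs.1
      have := hk_nonneg s hs
      have := n₀ x
      have := n₁ x
      have := nν x
      simp only [hf, Pi.zero_apply]
      positivity
    rw [hpath s hs]
    exact hellingerSq_withDensity_linear_combination h₀ h₁ hν hf0 rfl

end SqrtRnDeriv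

/-- The space of probability measures with the squared Hellinger
distance satisfies condition (NNCC-conv); in particular it is an NNCC space. -/
theorem hellinger_NNCC_conv {X : Type*} [MeasurableSpace X] :
    (∀ μ0 μ1 νbar : ProbabilityMeasure X,
      ∃ path : ℝ → ProbabilityMeasure X, path 0 = μ0 ∧ path 1 = μ1 ∧
        ∀ σ : ProbabilityMeasure X,
          ConvexOn ℝ (Set.Icc (0:ℝ) 1)
            (fun s => hellingerSq (path s : Measure X) (νbar : Measure X)
              - hellingerSq (path s : Measure X) (σ : Measure X))) ∧
    IsNNCC (fun μ ν : ProbabilityMeasure X =>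
      hellingerSq (μ : Measure X) (ν : Measure X)) := by
  have hconv : ∀ μ0 μ1 νbar : ProbabilityMeasure X,
      ∃ path : ℝ → ProbabilityMeasure X, path 0 = μ0 ∧ path 1 = μ1 ∧
        ∀ σ : ProbabilityMeasure X,
          ConvexOn ℝ (Set.Icc (0:ℝ) 1)
            (fun s => hellingerSq (path s : Measure X) (νbar : Measure X)
              - hellingerSq (path s : Measure X) (σ : Measure X)) := by
    intro μ₀ μ₁ ν
    obtain ⟨path, k, hpath0, hpath1, hk, hpath⟩ := exists_path_hellingerSq_eq μ₀ μ₁ ν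
    refine ⟨path, hpath0, hpath1, fun σ => ⟨convex_Icc 0 1, ?_⟩⟩
    intro x hx y hy α β hα hβ hαβ
    have hs := convex_Icc (0 : ℝ) 1 hx hy hα hβ hαβ
    have hconc := mul_le_mul_of_nonneg_right (hk.2 hx hy hα hβ hαβ)
      (hellingerSq_nonneg (ν : Measure X) (σ : Measure X))
    simp only [hpath _ hs, hpath _ hx, hpath _ hy, hellingerSq_self]
    obtain rfl : β = 1 - α := by linarith
    simp only [smul_eq_mul] at hconc ⊢
    linarith
  refine ⟨hconv, fun μ₀ μ₁ ν => ?_⟩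
  obtain ⟨path, hpath0, hpath1, hpath⟩ := hconv μ₀ μ₁ ν
  refine ⟨path, hpath0, hpath1, fun s hs σ => ?_⟩
  simpa using (hpath σ).2 (Set.left_mem_Icc.2 zero_le_one) (Set.right_mem_Icc.2 zero_le_one)
    (sub_nonneg.2 hs.2.le) hs.1.le (sub_add_cancel 1 s)
end

section
/- Let H be a real Hilbert space, 𝕊 = {x ∈ H : ‖x‖ = 1} its unit sphere, q ∈ [0,1), and let S ⊆ 𝕊 satisfy ⟨x,y⟩ ≥ q for all x, y ∈ S and be maximal under inclusion among subsets of 𝕊 with this property. Define D(x,y) = ‖x − y‖² on S × S. Then for all x₀, x₁, ȳ ∈ S there exists a path x : [0,1] → S with x(0) = x₀ and x(1) = x₁ such that for every y ∈ S the function s ↦ D(x(s),ȳ) − D(x(s),y) is convex on [0,1]. In particular (S × S, D) is an NNCC space. -/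
open scoped RealInnerProductSpace

section SphereLift

variable {H : Type*} [NormedAddCommGroup H] [InnerProductSpace ℝ H]

/-- The largest `t` for which `z + t • e` lies in the closed unit ball, where `e` is a unit vector
and `z` is in the closed unit ball. -/
noncomputable def sphereLift (e z : H) : ℝ :=
  √(⟪z, e⟫ ^ 2 + 1 - ‖z‖ ^ 2) - ⟪z, e⟫

theorem norm_add_smul_unit_sq {e : H} (he : ‖e‖ = 1) (z : H) (t : ℝ) :
    ‖z + t • e‖ ^ 2 = ‖z‖ ^ 2 + 2 * t * ⟪z, e⟫ + t ^ 2 := by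
  rw [norm_add_sq_real, real_inner_smul_right, norm_smul, he, mul_one, Real.norm_eq_abs, sq_abs]
  ring

theorem le_sphereLift {e z : H} {t : ℝ} (he : ‖e‖ = 1) (h : ‖z + t • e‖ ≤ 1) :
    t ≤ sphereLift e z := by
  have h1 : ‖z + t • e‖ ^ 2 ≤ 1 := pow_le_one₀ (norm_nonneg _) h
  rw [norm_add_smul_unit_sq he] at h1
  have h2 : t + ⟪z, e⟫ ≤ √(⟪z, e⟫ ^ 2 + 1 - ‖z‖ ^ 2) := Real.le_sqrt_of_sq_le (by linarith)
  unfold sphereLift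
  linarith

theorem sphereLift_nonneg {e z : H} (he : ‖e‖ = 1) (hz : ‖z‖ ≤ 1) : 0 ≤ sphereLift e z :=
  le_sphereLift he (by simpa using hz)

theorem norm_add_sphereLift_smul {e z : H} (he : ‖e‖ = 1) (hz : ‖z‖ ≤ 1) :
    ‖z + sphereLift e z • e‖ = 1 := by
  have hz' : ‖z‖ ^ 2 ≤ 1 := pow_le_one₀ (norm_nonneg _) hz
  have hs := Real.sq_sqrt (show 0 ≤ ⟪z, e⟫ ^ 2 + 1 - ‖z‖ ^ 2 by nlinarith [sq_nonneg ⟪z, e⟫])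
  rw [← pow_eq_one_iff_of_nonneg (norm_nonneg _) two_ne_zero, norm_add_smul_unit_sq he, sphereLift]
  linarith

theorem sphereLift_eq_zero {e z : H} (hz : ‖z‖ = 1) (hze : 0 ≤ ⟪z, e⟫) : sphereLift e z = 0 := by
  simp [sphereLift, hz, Real.sqrt_sq hze]

theorem concaveOn_sphereLift {e : H} (he : ‖e‖ = 1) :
    ConcaveOn ℝ (Metric.closedBall 0 1) (sphereLift e) := by
  refine ⟨convex_closedBall 0 1, fun z hz w hw a b ha hb hab => le_sphereLift he ?_⟩
  rw [mem_closedBall_zero_iff] at hz hw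
  have hmem := convex_closedBall (0 : H) 1
    (mem_closedBall_zero_iff.2 (norm_add_sphereLift_smul he hz).le)
    (mem_closedBall_zero_iff.2 (norm_add_sphereLift_smul he hw).le) ha hb hab
  rw [mem_closedBall_zero_iff] at hmem
  convert hmem using 1
  congr 1
  simp only [smul_eq_mul]
  module

end SphereLift

theorem norm_sub_sq_sub_norm_sub_sq {H : Type*} [NormedAddCommGroup H] [InnerProductSpace ℝ H]
    {x y z : H} (hyz : ‖y‖ = ‖z‖) :
    ‖x - y‖ ^ 2 - ‖x - z‖ ^ 2 = 2 * ⟪x, z - y⟫ := by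
  rw [norm_sub_sq_real, norm_sub_sq_real, inner_sub_right, hyz]
  ring

theorem isNNCC_of_convexOn {X Y : Type*} {c : X → Y → ℝ}
    (h : ∀ x0 x1 : X, ∀ ybar : Y, ∃ x : ℝ → X, x 0 = x0 ∧ x 1 = x1 ∧
      ∀ y : Y, ConvexOn ℝ (Set.Icc (0:ℝ) 1) (fun s => c (x s) ybar - c (x s) y)) :
    IsNNCC c := by
  intro x0 x1 ybar
  obtain ⟨x, h0, h1, hx⟩ := h x0 x1 ybar
  refine ⟨x, h0, h1, fun s hs y => ?_⟩
  simpa using (hx y).2 (Set.left_mem_Icc.2 zero_le_one) (Set.right_mem_Icc.2 zero_le_one)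
    (sub_nonneg.2 hs.2.le) hs.1.le (sub_add_cancel 1 s)

/-- A set of unit vectors that is maximal subject to the pairwise inner products being at least
`q` contains every unit vector whose inner products with its elements are at least `q`. -/
theorem mem_of_maximal_inner_ge {H : Type*} [NormedAddCommGroup H] [InnerProductSpace ℝ H]
    {q : ℝ} (hq : q ≤ 1) {S : Set H} (hS : ∀ x ∈ S, ‖x‖ = 1)
    (hq' : ∀ x ∈ S, ∀ y ∈ S, q ≤ ⟪x, y⟫)
    (hmax : ∀ T : Set H, (∀ x ∈ T, ‖x‖ = 1) → (∀ x ∈ T, ∀ y ∈ T, q ≤ ⟪x, y⟫) →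
      S ⊆ T → T = S)
    {x : H} (hx : ‖x‖ = 1) (hxS : ∀ y ∈ S, q ≤ ⟪x, y⟫) : x ∈ S := by
  rw [← hmax (insert x S) _ _ (Set.subset_insert x S)]
  · exact Set.mem_insert x S
  · rintro y (rfl | hy)
    exacts [hx, hS y hy]
  · rintro y (rfl | hy) z (rfl | hz)
    · simpa [real_inner_self_eq_norm_sq, hx] using hq
    · exact hxS z hz
    · rw [real_inner_comm]
      exact hxS y hy
    · exact hq' y hy z hz

/-- Let `S` be a maximal subset of the unit sphere of a real Hilbert
space on which all pairwise inner products are `≥ q` for some `q ∈ [0,1)`. Then for the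
squared ambient distance `D(x,y) = ‖x - y‖²`, any two points of `S` are joined, for any
base point, by a path along which the difference of costs is convex; in particular
`(S × S, D)` is an NNCC space. -/
theorem sphere_cap_NNCC_conv
    {H : Type*} [NormedAddCommGroup H] [InnerProductSpace ℝ H]
    (q : ℝ) (hq : q ∈ Set.Ico (0:ℝ) 1)
    (S : Set H) (hS : ∀ x ∈ S, ‖x‖ = 1)
    (hq' : ∀ x ∈ S, ∀ y ∈ S, q ≤ ⟪x, y⟫)
    (hmax : ∀ T : Set H, (∀ x ∈ T, ‖x‖ = 1) → (∀ x ∈ T, ∀ y ∈ T, q ≤ ⟪x, y⟫) →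
      S ⊆ T → T = S) :
    (∀ x0 x1 ybar : S,
      ∃ x : ℝ → S, x 0 = x0 ∧ x 1 = x1 ∧
        ∀ y : S, ConvexOn ℝ (Set.Icc (0:ℝ) 1)
          (fun s => ‖(x s : H) - (ybar : H)‖ ^ 2 - ‖(x s : H) - (y : H)‖ ^ 2)) ∧
    IsNNCC (fun a b : S => ‖(a : H) - (b : H)‖ ^ 2) := by
  have hpath : ∀ x0 x1 ybar : S, ∃ x : ℝ → S, x 0 = x0 ∧ x 1 = x1 ∧
      ∀ y : S, ConvexOn ℝ (Set.Icc (0:ℝ) 1)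
        (fun s => ‖(x s : H) - (ybar : H)‖ ^ 2 - ‖(x s : H) - (y : H)‖ ^ 2) := by
    rintro ⟨x0, h0⟩ ⟨x1, h1⟩ ⟨e, he⟩
    have hnorm : ‖e‖ = 1 := hS e he
    let z : ℝ →ᵃ[ℝ] H := AffineMap.lineMap x0 x1
    have hz : ∀ s, z s = (1 - s) • x0 + s • x1 := AffineMap.lineMap_apply_module x0 x1
    have hball : Set.Icc (0:ℝ) 1 ⊆ z ⁻¹' Metric.closedBall 0 1 := fun s hs => by
      rw [Set.mem_preimage, hz]
      exact convex_closedBall (0 : H) 1 (by simp [hS x0 h0]) (by simp [hS x1 h1])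
        (sub_nonneg.2 hs.2) hs.1 (sub_add_cancel 1 s)
    have hlift : ∀ s : ℝ, ∃ p : S, s ∈ Set.Icc (0:ℝ) 1 →
        (p : H) = z s + sphereLift e (z s) • e := by
      intro s
      by_cases hs : s ∈ Set.Icc (0:ℝ) 1
      · have hzs : ‖z s‖ ≤ 1 := mem_closedBall_zero_iff.1 (hball hs)
        refine ⟨⟨_, mem_of_maximal_inner_ge hq.2.le hS hq' hmax
          (norm_add_sphereLift_smul hnorm hzs) fun y hy => ?_⟩, fun _ => rfl⟩
        have ht := mul_nonneg (sphereLift_nonneg hnorm hzs) (hq.1.trans (hq' e he y hy))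
        have hy0 := mul_le_mul_of_nonneg_left (hq' x0 h0 y hy) (sub_nonneg.2 hs.2)
        have hy1 := mul_le_mul_of_nonneg_left (hq' x1 h1 y hy) hs.1
        have hzy : ⟪z s, y⟫ = (1 - s) * ⟪x0, y⟫ + s * ⟪x1, y⟫ := by
          rw [hz, inner_add_left, real_inner_smul_left, real_inner_smul_left]
        rw [inner_add_left, real_inner_smul_left, hzy]
        linarith
      · exact ⟨⟨e, he⟩, fun h => absurd h hs⟩
    choose x hx using hlift
    refine ⟨x, Subtype.ext ?_, Subtype.ext ?_, ?_⟩
    · rw [hx 0 (by simp)]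
      simp [z, sphereLift_eq_zero (hS x0 h0) (hq.1.trans (hq' x0 h0 e he))]
    · rw [hx 1 (by simp)]
      simp [z, sphereLift_eq_zero (hS x1 h1) (hq.1.trans (hq' x1 h1 e he))]
    · rintro ⟨y, hy⟩
      have hey : 0 ≤ ⟪e, e - y⟫ := by
        have := real_inner_le_norm e y
        rw [hnorm, hS y hy] at this
        rw [inner_sub_right, real_inner_self_eq_norm_sq, hnorm]
        linarith
      have hconc : ConcaveOn ℝ (Set.Icc (0:ℝ) 1) fun s => sphereLift e (z s) :=
        ((concaveOn_sphereLift hnorm).comp_affineMap z).subset hball (convex_Icc 0 1)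
      have haff : ConvexOn ℝ (Set.Icc (0:ℝ) 1) fun s => ⟪y - e, z s⟫ :=
        (((innerₗ H (y - e)).convexOn convex_univ).comp_affineMap z).subset
          (Set.subset_univ _) (convex_Icc 0 1)
      refine ((haff.sub (hconc.smul hey)).smul zero_le_two).congr fun s hs => ?_
      simp only [Pi.sub_apply, smul_eq_mul]
      rw [norm_sub_sq_sub_norm_sub_sq (hnorm.trans (hS y hy).symm), hx s hs, inner_add_left,
        real_inner_smul_left, real_inner_comm (z s), ← neg_sub y e, inner_neg_right]
      ring
  exact ⟨hpath, isNNCC_of_convexOn hpath⟩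
end
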